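/- arXiv:2505.17803 — 2 statements merged into one kernel-verified Lean document; each statement's English description precedes it below -/
import Mathlib

section
/- Let m ∈ ℕ, let 𝒰 be any family of nonempty subsets of {1,…,m} (the locally rejected index sets), and let 𝒳 = {I ⊆ {1,…,m} : I ≠ ∅ and every J with I ⊆ J ⊆ {1,…,m} satisfies J ∈ 𝒰} be the closed testing rejection family. Let T ⊆ {1,…,m} be nonempty with T ∉ 𝒰. Then for every nonempty R ⊆ {1,…,m}, |T ∩ R| ≤ c(R), where c(R) = max{|I| : ∅ ≠ I ⊆ R, I ∉ 𝒳} (with c(R) = 0 if every nonempty subset of R lies in 𝒳). -/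
open scoped Classical

/-- The closed testing rejection family determined by a family `𝒰` of locally rejected
(nonempty) index sets: `I` is rejected by closed testing iff `I` is nonempty and every
superset `J` of `I` is locally rejected. -/
def closedTestingFamily (m : ℕ) (𝒰 : Set (Finset (Fin m))) : Set (Finset (Fin m)) :=
  {I | I.Nonempty ∧ ∀ J : Finset (Fin m), I ⊆ J → J ∈ 𝒰}

/-- The closed-testing upper confidence bound for the number of false discoveries in a
discovery set `R`: `c(R) = max {|I| : ∅ ≠ I ⊆ R, I ∉ 𝒳}`, with `c(R) = 0` if every
nonempty subset of `R` is rejected by closed testing. -/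
noncomputable def ctBound (m : ℕ) (𝒰 : Set (Finset (Fin m))) (R : Finset (Fin m)) : ℕ :=
  ((R.powerset.filter
    (fun I => I.Nonempty ∧ I ∉ closedTestingFamily m 𝒰)).sup Finset.card)

/-- Deterministic core of the coverage proof: if the set `T` of true hypotheses is
nonempty and not locally rejected, then `|T ∩ R| ≤ c(R)` for every nonempty discovery
set `R`. -/
theorem tau_le_ctBound (m : ℕ) (𝒰 : Set (Finset (Fin m)))
    (h𝒰 : ∀ I ∈ 𝒰, I.Nonempty) (T : Finset (Fin m)) (hT : T.Nonempty)
    (hTU : T ∉ 𝒰) :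
    ∀ R : Finset (Fin m), R.Nonempty → (T ∩ R).card ≤ ctBound m 𝒰 R := by
  intro R _
  rcases (T ∩ R).eq_empty_or_nonempty with h | h
  · rw [h]; simp
  · unfold ctBound
    refine Finset.le_sup (f := Finset.card) ?_
    rw [Finset.mem_filter, Finset.mem_powerset]
    exact ⟨Finset.inter_subset_right, h, fun hX => hTU (hX.2 T Finset.inter_subset_left)⟩
end

section
/- Let m ∈ ℕ, α ∈ (0,1), let e_1,…,e_m be nonnegative reals, and let R ⊆ {1,…,m} be nonempty. Fix h with 1 ≤ h ≤ |R| and let K_h ⊆ R with |K_h| = h be a set of indices of the h smallest values among (e_i)_{i∈R} (i.e., e_i ≤ e_j for all i ∈ K_h and j ∈ R \ K_h). For each k with 0 ≤ k ≤ m − |R| let K̄_k ⊆ {1,…,m} \ R with |K̄_k| = k be a set of indices of the k smallest values among (e_j)_{j∉R} (i.e., e_i ≤ e_j for all i ∈ K̄_k and j ∈ ({1,…,m} \ R) \ K̄_k), with ∑_{j∈K̄_0} e_j = 0 by convention. Let k* ∈ {0,…,m−|R|} maximize k/α − ∑_{j∈K̄_k} e_j. If ∑_{i∈K_h} e_i −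 h/α < k*/α − ∑_{j∈K̄_{k*}} e_j, then K_h ∉ 𝒳_α, where 𝒳_α = {I : I ≠ ∅ and ∀ J with I ⊆ J ⊆ {1,…,m}, (1/|J|)∑_{i∈J} e_i ≥ 1/α} is the closed testing rejection family based on the average-based local e-test. -/
open scoped Classical

/-- The closed testing rejection family based on the average-based local e-test at
level `α` for realized e-values `e : Fin m → ℝ`: `I` is rejected iff `I` is nonempty and
every superset `J` of `I` satisfies `(1/|J|) ∑_{i∈J} e_i ≥ 1/α`. -/
def ctAvgRejected (m : ℕ) (α : ℝ) (e : Fin m → ℝ) : Set (Finset (Fin m)) :=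
  {I | I.Nonempty ∧ ∀ J : Finset (Fin m), I ⊆ J → 1 / α ≤ (∑ i ∈ J, e i) / J.card}

/-- Computational shortcut (Lemma 2): let `K h` consist of the indices of the `h`
smallest e-values inside the discovery set `R`, and `Kbar k` of the indices of the `k`
smallest e-values outside `R`.  If `k*` maximizes `k/α − ∑_{j ∈ Kbar k} e_j` over
`0 ≤ k ≤ m − |R|` and `∑_{i ∈ K h} e_i − h/α < k*/α − ∑_{j ∈ Kbar k*} e_j`, then `K h`
is not rejected by closed testing. -/
theorem shortcut_not_rejected (m : ℕ) (α : ℝ) (hα : α ∈ Set.Ioo (0 : ℝ) 1)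
    (e : Fin m → ℝ) (he : ∀ i, 0 ≤ e i) (R : Finset (Fin m)) (hR : R.Nonempty)
    (h : ℕ) (hh : 1 ≤ h ∧ h ≤ R.card)
    (K : Finset (Fin m)) (hKsub : K ⊆ R) (hKcard : K.card = h)
    (hKsmall : ∀ i ∈ K, ∀ j ∈ R \ K, e i ≤ e j)
    (Kbar : ℕ → Finset (Fin m))
    (hKbarsub : ∀ k ≤ m - R.card, Kbar k ⊆ Rᶜ)
    (hKbarcard : ∀ k ≤ m - R.card, (Kbar k).card = k)
    (hKbarsmall : ∀ k ≤ m - R.card, ∀ i ∈ Kbar k, ∀ j ∈ Rᶜ \ Kbar k, e i ≤ e j)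
    (kstar : ℕ) (hkstar : kstar ≤ m - R.card)
    (hmax : ∀ k ≤ m - R.card,
      (k : ℝ) / α - ∑ j ∈ Kbar k, e j ≤ (kstar : ℝ) / α - ∑ j ∈ Kbar kstar, e j)
    (hlt : (∑ i ∈ K, e i) - (h : ℝ) / α <
      (kstar : ℝ) / α - ∑ j ∈ Kbar kstar, e j) :
    K ∉ ctAvgRejected m α e := by
  rintro ⟨-, hrej⟩
  have hdisj : Disjoint K (Kbar kstar) := by
    rw [Finset.disjoint_left]
    intro x hx hx'
    exact Finset.mem_compl.mp (hKbarsub kstar hkstar hx') (hKsub hx)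
  have h1 := hrej (K ∪ Kbar kstar) Finset.subset_union_left
  rw [Finset.sum_union hdisj, Finset.card_union_of_disjoint hdisj, hKcard,
    hKbarcard kstar hkstar] at h1
  have hpos : (0 : ℝ) < ((h + kstar : ℕ) : ℝ) := by
    have := hh.1
    exact_mod_cast (by omega : 0 < h + kstar)
  rw [le_div_iff₀ hpos] at h1
  push_cast at h1
  have h2 : 1 / α * ((h : ℝ) + kstar) = (h : ℝ) / α + kstar / α := by ring
  linarith
end
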